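/- Subtracting one step of the exact solution from one step of the IQ-RBF Euler method yields the error recursion bound E_{n+1} ≤ (1/(2(1+ε_n²h²)))·(2 + h(2+ε_n²h²)(1+ε_n²h²)L_f)·E_n + h|τ_n|, where E_n = |v_n − u_n|, provided f is L_f-Lipschitz in its second argument. -/

import Mathlib

/-- One-step error recursion bound for the IQ-RBF Euler method. -/
theorem iq_euler_error_recursion (f : ℝ → ℝ → ℝ) (Lf h εn tn un vn τn un' vn' : ℝ)
    (hh : 0 < h)
    (hLip : ∀ t u v : ℝ, |f t v - f t u| ≤ Lf * |v - u|)
    (hu : un' = (h * (1 + εn^2 * h^2) * (2 + εn^2 * h^2) * f tn un + 2 * un) /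
          (2 * (1 + εn^2 * h^2)))
    (hv : vn' = (h * (1 + εn^2 * h^2) * (2 + εn^2 * h^2) * f tn vn + 2 * vn) /
          (2 * (1 + εn^2 * h^2)) + h * τn) :
    |vn' - un'| ≤
      (1 / (2 * (1 + εn^2 * h^2))) *
          (2 + h * (2 + εn^2 * h^2) * (1 + εn^2 * h^2) * Lf) * |vn - un|
        + h * |τn| := by
  have hs : 0 ≤ εn^2 * h^2 := by positivity
  subst hu hv
  generalize εn^2 * h^2 = s at hs ⊢
  have hk : 0 < 1 / (2 * (1 + s)) := by positivity
  have hc : 0 ≤ h * (2 + s) * (1 + s) := by positivity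
  have e : (h * (1 + s) * (2 + s) * f tn vn + 2 * vn) / (2 * (1 + s)) + h * τn
      - (h * (1 + s) * (2 + s) * f tn un + 2 * un) / (2 * (1 + s))
      = 1 / (2 * (1 + s)) * (2 * (vn - un) + h * (2 + s) * (1 + s) * (f tn vn - f tn un))
        + h * τn := by
    ring
  have h1 : |2 * (vn - un) + h * (2 + s) * (1 + s) * (f tn vn - f tn un)|
      ≤ (2 + h * (2 + s) * (1 + s) * Lf) * |vn - un| := by
    refine (abs_add_le _ _).trans ?_
    rw [abs_mul, abs_mul (h * (2 + s) * (1 + s)), abs_of_nonneg hc, abs_two]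
    have := mul_le_mul_of_nonneg_left (hLip tn un vn) hc
    linarith
  rw [e]
  refine (abs_add_le _ _).trans ?_
  rw [abs_mul, abs_mul h, abs_of_pos hk, abs_of_pos hh, mul_assoc (1 / (2 * (1 + s)))]
  have := mul_le_mul_of_nonneg_left h1 hk.le
  linarith
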